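/- No identifier-independent, unbounded, filter-based semantics is *-composable: if a semantics S is filter-based, identifier-independent and unbounded, then there exist a database D and a regular expression R such that (S(D,R))* is not a subset of S(D, R*). -/

import Mathlib

namespace RPQ

/-- Vertex identifiers. -/
abbrev V : Type := ℕ
/-- Edge identifiers. -/
abbrev Edg : Type := ℕ
/-- Labels. -/
abbrev Lab : Type := ℕ

/-- A walk: a nonempty alternating sequence `v₀,e₁,v₁,…,e_k,v_k`, encoded as the
initial vertex together with the list of (edge, next-vertex) pairs. -/
structure Walk where
  head : V
  steps : List (Edg × V)
deriving DecidableEq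

namespace Walk

def length (w : Walk) : ℕ := w.steps.length
def src (w : Walk) : V := w.head
def tgt (w : Walk) : V := (w.steps.map Prod.snd).getLastD w.head
/-- The pair of endpoints of a walk. -/
def ep (w : Walk) : V × V := (w.src, w.tgt)
def vertexList (w : Walk) : List V := w.head :: w.steps.map Prod.snd
def edgeList (w : Walk) : List Edg := w.steps.map Prod.fst
/-- Concatenation of walks (meaningful when `w.tgt = w'.src`). -/
def concat (w w' : Walk) : Walk := ⟨w.head, w.steps ++ w'.steps⟩

end Walk

/-- A graph database. -/
structure Database where
  labels : Finset Lab
  verts : Finset V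
  edges : Finset Edg
  src : Edg → V
  tgt : Edg → V
  lbl : Edg → Lab
  src_mem : ∀ e ∈ edges, src e ∈ verts
  tgt_mem : ∀ e ∈ edges, tgt e ∈ verts
  lbl_mem : ∀ e ∈ edges, lbl e ∈ labels

def chainFrom (D : Database) : V → List (Edg × V) → Prop
  | _, [] => True
  | v, (e, v') :: rest =>
      e ∈ D.edges ∧ D.src e = v ∧ D.tgt e = v' ∧ chainFrom D v' rest

/-- `w` is consistent with `D`, i.e. `w` is a walk in `D`. -/
def Walk.Consistent (D : Database) (w : Walk) : Prop :=
  w.head ∈ D.verts ∧ chainFrom D w.head w.steps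

/-- The set of walks in `D`. -/
def Walks (D : Database) : Set Walk := {w | w.Consistent D}

/-- The label of a walk in `D`: the word of its successive edge labels. -/
def Walk.label (D : Database) (w : Walk) : List Lab :=
  w.steps.map fun p => D.lbl p.1

abbrev RE := RegularExpression Lab

/-- Matches of `R` in `D`: walks in `D` whose label conforms to `R`. -/
def Matches (D : Database) (R : RE) : Set Walk :=
  {w | w.Consistent D ∧ w.label D ∈ R.matches'}

/-- A semantics maps a database and a query to a finite subset of its matches. -/
def IsSemantics (S : Database → RE → Set Walk) : Prop :=
  ∀ D R, S D R ⊆ Matches D R ∧ (S D R).Finite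

/-- `S` is walk-based. -/
def WalkBased (S : Database → RE → Set Walk) : Prop :=
  ∃ r : Set Walk → Set Walk, ∀ D R, S D R = r (Matches D R)

/-- The semantics defined by a filter `f`. -/
def FilterSem (f : Walk → Bool) (D : Database) (R : RE) : Set Walk :=
  {w ∈ Matches D R | f w = true}

/-- Componentwise inclusion of databases. -/
def Database.Sub (D D' : Database) : Prop :=
  D.labels ⊆ D'.labels ∧ D.verts ⊆ D'.verts ∧ D.edges ⊆ D'.edges ∧
    ∀ e ∈ D.edges, D'.src e = D.src e ∧ D'.tgt e = D.tgt e ∧ D'.lbl e = D.lbl e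

def IsPartialOrderRel (le : Walk → Walk → Prop) : Prop :=
  (∀ w, le w w) ∧ (∀ a b c, le a b → le b c → le a c) ∧ ∀ a b, le a b → le b a → a = b

/-- `le` is a well-partial-order on the walks of `D`. -/
def IsWpoOn (le : Walk → Walk → Prop) (D : Database) : Prop :=
  ∀ f : ℕ → Walk, (∀ n, (f n).Consistent D) → ∃ i j, i < j ∧ le (f i) (f j)

/-- Suitable order: a partial order on walks that is a wpo on `Walks D` for each `D`. -/
def Suitable (le : Walk → Walk → Prop) : Prop :=
  IsPartialOrderRel le ∧ ∀ D, IsWpoOn le D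

/-- The semantics based on the order `le`: the `le`-minimal matches among those
with the same endpoints. -/
def OrderSem (le : Walk → Walk → Prop) (D : Database) (R : RE) : Set Walk :=
  {w ∈ Matches D R | ∀ w' ∈ Matches D R, w'.ep = w.ep → le w' w → w' = w}

def Monotonous (S : Database → RE → Set Walk) : Prop :=
  ∀ D D' R, D.Sub D' → S D R ⊆ S D' R

def CoMonotonous (S : Database → RE → Set Walk) : Prop :=
  ∀ D D' R, D.Sub D' → S D' R ∩ Walks D ⊆ S D R

def Stabilizing (S : Database → RE → Set Walk) : Prop :=
  ∀ (D : Database) (Rs : ℕ → RE),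
    (∀ i j, i ≤ j → ∀ u, u ∈ (Rs i).matches' → u ∈ (Rs j).matches') →
    ∃ N, ∀ n, N ≤ n → S D (Rs n) = S D (Rs N)

/-- Concatenation lifted to sets of walks. -/
def setConcat (W W' : Set Walk) : Set Walk :=
  {u | ∃ w ∈ W, ∃ w' ∈ W', w.tgt = w'.src ∧ u = w.concat w'}

/-- `setStar W` : all concatenations `w₁·…·w_k` (k ≥ 1) of walks of `W`. -/
inductive setStar (W : Set Walk) : Walk → Prop
  | base : ∀ w ∈ W, setStar W w
  | step : ∀ u w, setStar W u → w ∈ W → u.tgt = w.src → setStar W (u.concat w)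

/-- Walks jointly consistent with some database. -/
def ConsistentPair (w w' : Walk) : Prop :=
  ∃ D : Database, w.Consistent D ∧ w'.Consistent D

/-- The trimming of an order. -/
def trimRel (le : Walk → Walk → Prop) (w w' : Walk) : Prop :=
  ConsistentPair w w' ∧ w.ep = w'.ep ∧ le w w'

def Trimmed (le : Walk → Walk → Prop) : Prop := trimRel le = le

/-- `le` respects element inclusion. -/
def RespectsElemIncl (le : Walk → Walk → Prop) : Prop :=
  ∀ w w', le w w' →
    (∀ v ∈ w.vertexList, v ∈ w'.vertexList) ∧ ∀ e ∈ w.edgeList, e ∈ w'.edgeList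

/-- Action of a relabeling on a database. -/
def Database.relabel (π : Equiv.Perm Lab) (D : Database) : Database where
  labels := D.labels.image (⇑π)
  verts := D.verts
  edges := D.edges
  src := D.src
  tgt := D.tgt
  lbl := fun e => π (D.lbl e)
  src_mem := D.src_mem
  tgt_mem := D.tgt_mem
  lbl_mem := fun e he => Finset.mem_image_of_mem (⇑π) (D.lbl_mem e he)

/-- Action of a renaming on a walk. -/
def Walk.rename (νv : Equiv.Perm V) (νe : Equiv.Perm Edg) (w : Walk) : Walk :=
  ⟨νv w.head, w.steps.map fun p => (νe p.1, νv p.2)⟩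

/-- Action of a renaming on a database. -/
def Database.rename (νv : Equiv.Perm V) (νe : Equiv.Perm Edg) (D : Database) :
    Database where
  labels := D.labels
  verts := D.verts.image (⇑νv)
  edges := D.edges.image (⇑νe)
  src := fun e => νv (D.src (νe.symm e))
  tgt := fun e => νv (D.tgt (νe.symm e))
  lbl := fun e => D.lbl (νe.symm e)
  src_mem := by
    intro e he
    obtain ⟨e', he', rfl⟩ := Finset.mem_image.mp he
    simpa using Finset.mem_image_of_mem (⇑νv) (D.src_mem e' he')
  tgt_mem := by
    intro e he
    obtain ⟨e', he', rfl⟩ := Finset.mem_image.mp he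
    simpa using Finset.mem_image_of_mem (⇑νv) (D.tgt_mem e' he')
  lbl_mem := by
    intro e he
    obtain ⟨e', he', rfl⟩ := Finset.mem_image.mp he
    simpa using D.lbl_mem e' he'

/-- Identifier independence. -/
def IdIndependent (S : Database → RE → Set Walk) : Prop :=
  ∀ (νv : Equiv.Perm V) (νe : Equiv.Perm Edg) (D : Database) (R : RE),
    Walk.rename νv νe '' S D R = S (Database.rename νv νe D) R

/-- Unbounded semantics. -/
def Unbounded (S : Database → RE → Set Walk) : Prop :=
  ∀ n : ℕ, ∃ (D : Database) (R : RE) (w : Walk), w ∈ S D R ∧ n ≤ w.length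

/-- Shortest-walk semantics. -/
def Sh (D : Database) (R : RE) : Set Walk :=
  {w ∈ Matches D R | ∀ w' ∈ Matches D R, w'.ep = w.ep → w.length ≤ w'.length}

/-- The factor-inserting relation `F`. -/
def FactorIns (w w' : Walk) : Prop :=
  ∃ w₁ w₂ w₃ : Walk, w₁.tgt = w₂.src ∧ w₂.tgt = w₃.src ∧ w₁.tgt = w₃.src ∧
    w = w₁.concat w₃ ∧ w' = (w₁.concat w₂).concat w₃

/-- The subwalk order: reflexive–transitive closure of `FactorIns`. -/
def SubwalkOrd : Walk → Walk → Prop := Relation.ReflTransGen FactorIns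

/-- The database obtained by replacing every label by `0`. -/
def Database.unlabel (D : Database) : Database where
  labels := {0}
  verts := D.verts
  edges := D.edges
  src := D.src
  tgt := D.tgt
  lbl := fun _ => 0
  src_mem := D.src_mem
  tgt_mem := D.tgt_mem
  lbl_mem := fun _ _ => Finset.mem_singleton_self 0

/-- The union of two databases; on shared edges, the data of the first one is used. -/
def Database.union (D D' : Database) : Database where
  labels := D.labels ∪ D'.labels
  verts := D.verts ∪ D'.verts
  edges := D.edges ∪ D'.edges
  src := fun e => if e ∈ D.edges then D.src e else D'.src e
  tgt := fun e => if e ∈ D.edges then D.tgt e else D'.tgt e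
  lbl := fun e => if e ∈ D.edges then D.lbl e else D'.lbl e
  src_mem := by
    intro e he
    have := D.src_mem e
    have := D'.src_mem e
    grind
  tgt_mem := by
    intro e he
    have := D.tgt_mem e
    have := D'.tgt_mem e
    grind
  lbl_mem := by
    intro e he
    have := D.lbl_mem e
    have := D'.lbl_mem e
    grind

theorem Database.sub_union_left (D D' : Database) : D.Sub (D.union D') := by
  refine ⟨Finset.subset_union_left, Finset.subset_union_left, Finset.subset_union_left, ?_⟩
  intro e he
  simp [Database.union, he]

theorem Database.sub_union_right {D D' : Database} (h : Disjoint D.edges D'.edges) :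
    D'.Sub (D.union D') := by
  refine ⟨Finset.subset_union_right, Finset.subset_union_right, Finset.subset_union_right, ?_⟩
  intro e he
  simp [Database.union, Finset.disjoint_right.mp h he]

theorem chainFrom.mono {D D' : Database} (h : D.Sub D') {v : V} {l : List (Edg × V)}
    (hl : chainFrom D v l) : chainFrom D' v l := by
  induction l generalizing v with
  | nil => trivial
  | cons p l ih =>
    obtain ⟨he, hs, ht, hr⟩ := hl
    obtain ⟨hs', ht', -⟩ := h.2.2.2 _ he
    exact ⟨h.2.2.1 he, hs'.trans hs, ht'.trans ht, ih hr⟩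

theorem Walk.Consistent.mono {D D' : Database} (h : D.Sub D') {w : Walk}
    (hw : w.Consistent D) : w.Consistent D' :=
  ⟨h.2.1 hw.1, hw.2.mono h⟩

theorem chainFrom.unlabel {D : Database} {v : V} {l : List (Edg × V)}
    (hl : chainFrom D v l) : chainFrom D.unlabel v l := by
  induction l generalizing v with
  | nil => trivial
  | cons p l ih =>
    obtain ⟨he, hs, ht, hr⟩ := hl
    exact ⟨he, hs, ht, ih hr⟩

theorem Walk.Consistent.mem_matches_unlabel {D : Database} {w : Walk} (hw : w.Consistent D) :
    w ∈ Matches D.unlabel (RegularExpression.char 0).star := by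
  refine ⟨⟨hw.1, hw.2.unlabel⟩, ?_⟩
  rw [RegularExpression.matches'_star, Language.mem_kstar]
  refine ⟨w.steps.map fun _ => [0], ?_, ?_⟩
  · simp [Walk.label, Database.unlabel]
  · intro y hy
    obtain ⟨-, -, rfl⟩ := List.mem_map.mp hy
    exact rfl

namespace Walk

@[simp] theorem src_concat (w w' : Walk) : (w.concat w').src = w.src := rfl

@[simp] theorem length_concat (w w' : Walk) :
    (w.concat w').length = w.length + w'.length := by
  simp [length, concat]

theorem tgt_concat {w w' : Walk} (h : w.tgt = w'.src) : (w.concat w').tgt = w'.tgt := by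
  rcases w' with ⟨v, l⟩
  rcases List.eq_nil_or_concat l with rfl | ⟨l, p, rfl⟩
  · simpa [concat, tgt, src] using h
  · simp [concat, tgt, List.getLastD_eq_getLast?, List.getLast?_append]

@[simp] theorem src_rename (νv : Equiv.Perm V) (νe : Equiv.Perm Edg) (w : Walk) :
    (w.rename νv νe).src = νv w.src := rfl

@[simp] theorem tgt_rename (νv : Equiv.Perm V) (νe : Equiv.Perm Edg) (w : Walk) :
    (w.rename νv νe).tgt = νv w.tgt := by
  rcases w with ⟨v, l⟩
  rcases List.eq_nil_or_concat l with rfl | ⟨l, p, rfl⟩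
  · rfl
  · simp [rename, tgt, List.getLastD_eq_getLast?]

end Walk

theorem exists_perm_disjoint_image (s : Finset ℕ) :
    ∃ ν : Equiv.Perm ℕ, Disjoint s (s.image ν) := by
  let N := s.sup id + 1
  let g : ℕ → ℕ := fun e => if e < N then e + N else if e < 2 * N then e - N else e
  have hg : Function.Involutive g := by
    intro e
    simp only [g]
    split_ifs <;> omega
  have hN : ∀ e ∈ s, e < N := fun e he => Nat.lt_succ_of_le (Finset.le_sup (f := id) he)
  refine ⟨hg.toPerm, Finset.disjoint_right.mpr ?_⟩
  intro e he hes
  obtain ⟨e', he', rfl⟩ := Finset.mem_image.mp he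
  have h1 := hN _ he'
  have h2 := hN _ hes
  simp only [Function.Involutive.coe_toPerm, g, h1, if_true] at h2
  omega

/-- A walk and a return walk in `W`, not both trivial, generate infinitely many walks. -/
theorem setStar_infinite {W : Set Walk} {w w' : Walk} (hw : w ∈ W) (hw' : w' ∈ W)
    (h : w.tgt = w'.src) (h' : w'.tgt = w.src) (hlen : 1 ≤ w.length) :
    {u | setStar W u}.Infinite := by
  have key : ∀ n : ℕ, ∃ u, setStar W u ∧ u.tgt = w.src ∧ n < u.length := by
    intro n
    induction n with
    | zero =>
      refine ⟨_, .step _ _ (.base _ hw) hw' h, (Walk.tgt_concat h).trans h', ?_⟩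
      rw [Walk.length_concat]
      omega
    | succ n ih =>
      obtain ⟨u, hu, ht, hn⟩ := ih
      have h₁ : (u.concat w).tgt = w'.src := (Walk.tgt_concat ht).trans h
      refine ⟨_, .step _ _ (.step _ _ hu hw ht) hw' h₁, (Walk.tgt_concat h₁).trans h', ?_⟩
      simp only [Walk.length_concat]
      omega
  refine Set.Infinite.of_image Walk.length (Set.infinite_of_forall_exists_gt fun n => ?_)
  obtain ⟨u, hu, -, hn⟩ := key n
  exact ⟨_, Set.mem_image_of_mem _ hu, hn⟩

/-- No identifier-independent, unbounded, filter-based semantics is *-composable. -/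
theorem no_filterBased_starComposable
    (S : Database → RE → Set Walk) (hS : IsSemantics S) (f : Walk → Bool)
    (hf : ∀ D R, S D R = FilterSem f D R)
    (hid : IdIndependent S) (hub : Unbounded S) :
    ∃ (D : Database) (R : RE),
      ¬ ({w | setStar (S D R) w} ⊆ S D R.star) := by
  obtain ⟨D, R, w, hw, hlen⟩ := hub 1
  obtain ⟨⟨hwD, -⟩, hfw⟩ := hf D R ▸ hw
  obtain ⟨νe, hνe⟩ := exists_perm_disjoint_image D.edges
  let νv : Equiv.Perm V := Equiv.swap w.src w.tgt
  have hw' : w.rename νv νe ∈ S (D.rename νv νe) R :=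
    hid νv νe D R ▸ Set.mem_image_of_mem _ hw
  obtain ⟨⟨hwD', -⟩, hfw'⟩ := hf _ R ▸ hw'
  let U := D.union (D.rename νv νe)
  refine ⟨U.unlabel, (RegularExpression.char 0).star, fun hsub => ?_⟩
  have mem : ∀ u : Walk, u.Consistent U → f u = true →
      u ∈ S U.unlabel (RegularExpression.char 0).star := by
    intro u hu hfu
    rw [hf]
    exact ⟨hu.mem_matches_unlabel, hfu⟩
  refine setStar_infinite (mem _ (hwD.mono (Database.sub_union_left _ _)) hfw)
    (mem _ (hwD'.mono (Database.sub_union_right hνe)) hfw') ?_ ?_ hlen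
    ((hS _ _).2.subset hsub)
  · simp [νv]
  · simp [νv]

end RPQ
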